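/- Let m > 2 be an integer, let p₁ : ℝ → ℝ be 2π-periodic and C², and let u₁ : ℝ → ℝ be 2π-periodic and continuous. Then the following are equivalent: (i) sup_{t∈ℝ} | E^m(1 + ε p₁, id + ε u₁)(t) | = O(ε²) as ε → 0⁺; (ii) for every k ∈ ℤ with m ∤ k, û₁(k) = a_{m,k} · p̂₁(k), and for every k ∈ ℤ \ {0} with m | k, p̂₁(k) = 0, where a_{m,k} := i ( k · cot²(πk/m) − cot(π/m) · cot(πk/m) ). -/

import Mathlib

open Real

/-- The generating function `L_p(t,t')` of the billiard in the convex domain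
with support function `p`. -/
noncomputable def genfun (p : ℝ → ℝ) (t t' : ℝ) : ℝ :=
  Real.sqrt (p t ^ 2 + deriv p t ^ 2 + p t' ^ 2 + deriv p t' ^ 2
    - 2 * p t * p t' * Real.cos (t - t')
    - 2 * p t * deriv p t' * Real.sin (t - t')
    + 2 * deriv p t * p t' * Real.sin (t - t')
    - 2 * deriv p t * deriv p t' * Real.cos (t - t'))

/-- The error function `E^m(p,u)(t) = ∂₁L_p(u(t), u(t+2π/m)) + ∂₂L_p(u(t−2π/m), u(t))`. -/
noncomputable def errfun (m : ℕ) (p u : ℝ → ℝ) (t : ℝ) : ℝ :=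
  deriv (fun s => genfun p s (u (t + 2 * Real.pi / m))) (u t)
    + deriv (fun s => genfun p (u (t - 2 * Real.pi / m)) s) (u t)

/-- The `k`-th Fourier coefficient of a 2π-periodic function `f`. -/
noncomputable def fourierCoef (f : ℝ → ℝ) (k : ℤ) : ℂ :=
  (1 / (2 * Real.pi)) * ∫ t in (0:ℝ)..(2 * Real.pi),
    (f t : ℂ) * Complex.exp (-Complex.I * k * t)

open Filter Topology Asymptotics

/-- The filter on pairs `(ε, t)` along which `ε → 0⁺`, uniformly in `t`. -/
abbrev uniformZero : Filter (ℝ × ℝ) := 𝓝[>] (0 : ℝ) ×ˢ (⊤ : Filter ℝ)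

/-- `f (ε, t) = a + ε * b t + O(ε²)` as `ε → 0⁺`, uniformly in `t`, with `b` bounded. -/
structure HasJet (f : ℝ × ℝ → ℝ) (a : ℝ) (b : ℝ → ℝ) : Prop where
  bounded : (fun z : ℝ × ℝ => b z.2) =O[uniformZero] fun _ => (1 : ℝ)
  remainder : (fun z => f z - (a + z.1 * b z.2)) =O[uniformZero] fun z => z.1 ^ 2

theorem tendsto_fst_uniformZero : Tendsto Prod.fst uniformZero (𝓝 (0 : ℝ)) :=
  tendsto_fst.mono_right nhdsWithin_le_nhds

theorem isBigO_uniformZero_iff {f : ℝ × ℝ → ℝ} :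
    f =O[uniformZero] (fun z => z.1 ^ 2) ↔
      ∃ C > 0, ∃ ε₁ > 0, ∀ ε : ℝ, 0 < ε → ε ≤ ε₁ → ∀ t : ℝ, |f (ε, t)| ≤ C * ε ^ 2 := by
  have key (C : ℝ) : (∀ᶠ z : ℝ × ℝ in uniformZero, ‖f z‖ ≤ C * ‖z.1 ^ 2‖) ↔
      ∃ ε₁ > 0, ∀ ε : ℝ, 0 < ε → ε ≤ ε₁ → ∀ t : ℝ, |f (ε, t)| ≤ C * ε ^ 2 := by
    rw [Filter.Eventually, mem_prod_top]
    simp only [Set.mem_ofPred_eq, Real.norm_eq_abs, abs_pow, sq_abs]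
    rw [mem_nhdsGT_iff_exists_Ioc_subset]
    simp [Set.subset_def]
  rw [isBigO_iff']
  exact exists_congr fun C => and_congr_right fun _ => key C

theorem isBigO_fst_one : (Prod.fst : ℝ × ℝ → ℝ) =O[uniformZero] fun _ => (1 : ℝ) :=
  tendsto_fst_uniformZero.isBigO_one ℝ

theorem isBigO_fst_sq_fst :
    (fun z : ℝ × ℝ => z.1 ^ 2) =O[uniformZero] (Prod.fst : ℝ × ℝ → ℝ) := by
  simpa [sq] using (isBigO_refl (Prod.fst : ℝ × ℝ → ℝ) uniformZero).mul isBigO_fst_one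

theorem isBigO_snd_one {b : ℝ → ℝ} {M : ℝ} (hb : ∀ t, |b t| ≤ M) :
    (fun z : ℝ × ℝ => b z.2) =O[uniformZero] fun _ => (1 : ℝ) :=
  .of_bound M (.of_forall fun z => by simpa using hb z.2)

namespace HasJet

variable {f g : ℝ × ℝ → ℝ} {a c : ℝ} {b d : ℝ → ℝ}

theorem sub_const_isBigO (hf : HasJet f a b) :
    (fun z => f z - a) =O[uniformZero] (Prod.fst : ℝ × ℝ → ℝ) := by
  have h1 := hf.remainder.trans isBigO_fst_sq_fst
  have h2 : (fun z : ℝ × ℝ => z.1 * b z.2) =O[uniformZero] (Prod.fst : ℝ × ℝ → ℝ) := by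
    simpa using (isBigO_refl (Prod.fst : ℝ × ℝ → ℝ) uniformZero).mul hf.bounded
  exact (h1.add h2).congr_left fun z => by ring

theorem tendsto (hf : HasJet f a b) : Tendsto f uniformZero (𝓝 a) := by
  simpa using (hf.sub_const_isBigO.trans_tendsto tendsto_fst_uniformZero).add_const a

theorem isBigO_one (hf : HasJet f a b) : f =O[uniformZero] fun _ => (1 : ℝ) :=
  hf.tendsto.isBigO_one ℝ

theorem const (a : ℝ) : HasJet (fun _ => a) a (fun _ => 0) :=
  ⟨isBigO_zero _ _, by simpa using isBigO_zero _ _⟩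

theorem add (hf : HasJet f a b) (hg : HasJet g c d) :
    HasJet (fun z => f z + g z) (a + c) (fun t => b t + d t) :=
  ⟨hf.bounded.add hg.bounded,
    (hf.remainder.add hg.remainder).congr_left fun z => by ring⟩

theorem sub (hf : HasJet f a b) (hg : HasJet g c d) :
    HasJet (fun z => f z - g z) (a - c) (fun t => b t - d t) :=
  ⟨hf.bounded.sub hg.bounded,
    (hf.remainder.sub hg.remainder).congr_left fun z => by ring⟩

theorem mul (hf : HasJet f a b) (hg : HasJet g c d) :
    HasJet (fun z => f z * g z) (a * c) (fun t => a * d t + b t * c) := by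
  refine ⟨(hg.bounded.const_mul_left a).add ?_, ?_⟩
  · exact (hf.bounded.const_mul_left c).congr_left fun z => by ring
  · have h1 := hf.remainder.mul hg.isBigO_one
    have h2 := hg.remainder.const_mul_left a
    have h3 := (isBigO_fst_one.mul (hf.bounded.mul hg.remainder))
    have h4 := (isBigO_refl (fun z : ℝ × ℝ => z.1 ^ 2) uniformZero).mul
      (hf.bounded.mul hg.bounded)
    simp only [mul_one, one_mul] at h1 h3 h4
    exact (((h1.add h2).add h3).add h4).congr_left fun z => by ring

theorem comp {φ : ℝ → ℝ} {φ' : ℝ} (hf : HasJet f a b) (hφ : AnalyticAt ℝ φ a)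
    (hφ' : HasDerivAt φ φ' a) : HasJet (fun z => φ (f z)) (φ a) (fun t => φ' * b t) := by
  refine ⟨hf.bounded.const_mul_left φ', ?_⟩
  obtain ⟨p, hp⟩ := hφ
  have hT := hp.isBigO_sub_partialSum_pow 2
  have hlim : Tendsto (fun z => f z - a) uniformZero (𝓝 0) :=
    hf.sub_const_isBigO.trans_tendsto tendsto_fst_uniformZero
  have h0 : ∀ v, p 0 v = φ a := hp.coeff_zero
  have h1 : ∀ y : ℝ, p 1 (fun _ => y) = y * φ' := fun y => by
    have : p 1 (fun _ => y) = y • p 1 (fun _ => 1) := by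
      simp
    rw [this, hp.hasDerivAt.unique hφ', smul_eq_mul]
  have h2 := hT.comp_tendsto hlim
  have h3 : (fun z => φ (f z) - (φ a + (f z - a) * φ')) =O[uniformZero]
      fun z : ℝ × ℝ => z.1 ^ 2 := by
    refine (h2.congr_left fun z => ?_).trans ?_
    · simp only [Function.comp_apply, FormalMultilinearSeries.partialSum, Finset.sum_range_succ,
        Finset.sum_range_zero, zero_add, h0, h1, add_sub_cancel]
    · simpa [Function.comp_def] using hf.sub_const_isBigO.pow 2
  exact (h3.add (hf.remainder.const_mul_left φ')).congr_left fun z => by ring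

theorem congr_coeff {c : ℝ} {d : ℝ → ℝ} (hf : HasJet f a b) (hc : a = c) (hd : ∀ t, b t = d t) :
    HasJet f c d := by
  obtain rfl := hc
  obtain rfl : b = d := funext hd
  exact hf

end HasJet

/-- The component of `γ x - γ y` along the unit tangent at `x`, where `γ` is the curve with
support function `p`. -/
noncomputable def tangentialComp (p : ℝ → ℝ) (x y : ℝ) : ℝ :=
  deriv p x + p y * sin (x - y) - deriv p y * cos (x - y)

/-- The squared distance `‖γ x - γ y‖²`, where `γ` is the curve with support function `p`. -/
noncomputable def sqDist (p : ℝ → ℝ) (x y : ℝ) : ℝ :=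
  p x ^ 2 + deriv p x ^ 2 + p y ^ 2 + deriv p y ^ 2
    - 2 * p x * p y * cos (x - y) - 2 * p x * deriv p y * sin (x - y)
    + 2 * deriv p x * p y * sin (x - y) - 2 * deriv p x * deriv p y * cos (x - y)

theorem genfun_eq_sqrt (p : ℝ → ℝ) (x y : ℝ) : genfun p x y = √(sqDist p x y) := rfl

theorem genfun_comm (p : ℝ → ℝ) (x y : ℝ) : genfun p x y = genfun p y x := by
  rw [genfun_eq_sqrt, genfun_eq_sqrt]
  congr 1
  simp only [sqDist]
  rw [← neg_sub y x, cos_neg, sin_neg]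
  ring

theorem hasDerivAt_genfun {p : ℝ → ℝ} (hp : ContDiff ℝ 2 p) {x y : ℝ} (h : 0 < sqDist p x y) :
    HasDerivAt (fun s => genfun p s y)
      ((p x + deriv (deriv p) x) * (tangentialComp p x y * (√(sqDist p x y))⁻¹)) x := by
  have h0 : HasDerivAt p (deriv p x) x := (hp.differentiable (by norm_num) x).hasDerivAt
  have h1 : HasDerivAt (deriv p) (deriv (deriv p) x) x :=
    ((hp.deriv' (n := 1)).differentiable (by norm_num) x).hasDerivAt
  have hx : HasDerivAt (fun s => s - y) 1 x := (hasDerivAt_id x).sub_const y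
  have hsq := (((((((h0.pow 2).add (h1.pow 2)).add_const (p y ^ 2)).add_const
    (deriv p y ^ 2)).sub ((h0.const_mul 2).mul_const (p y) |>.mul hx.cos)).sub
    ((h0.const_mul 2).mul_const (deriv p y) |>.mul hx.sin)).add
    ((h1.const_mul 2).mul_const (p y) |>.mul hx.sin)).sub
    ((h1.const_mul 2).mul_const (deriv p y) |>.mul hx.cos)
  have hs : √(sqDist p x y) ≠ 0 := (Real.sqrt_pos.2 h).ne'
  refine (HasDerivAt.sqrt (f := fun s => sqDist p s y) hsq h.ne').congr_deriv ?_
  simp only [tangentialComp]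
  field_simp
  ring

theorem errfun_eq {m : ℕ} {p u : ℝ → ℝ} (hp : ContDiff ℝ 2 p) {t : ℝ}
    (h1 : 0 < sqDist p (u t) (u (t + 2 * π / m)))
    (h2 : 0 < sqDist p (u t) (u (t + -(2 * π / m)))) :
    errfun m p u t = (p (u t) + deriv (deriv p) (u t)) *
      (tangentialComp p (u t) (u (t + 2 * π / m)) * (√(sqDist p (u t) (u (t + 2 * π / m))))⁻¹
      + tangentialComp p (u t) (u (t + -(2 * π / m))) *
        (√(sqDist p (u t) (u (t + -(2 * π / m)))))⁻¹) := by
  simp only [errfun, genfun_comm p (u (t - 2 * π / m))]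
  rw [← sub_eq_add_neg] at h2 ⊢
  rw [(hasDerivAt_genfun hp h1).deriv, (hasDerivAt_genfun hp h2).deriv]
  ring

theorem periodic_deriv {f : ℝ → ℝ} {c : ℝ} (hf : Function.Periodic f c) :
    Function.Periodic (deriv f) c := fun x => by
  rw [← deriv_comp_add_const, show (fun y => f (y + c)) = f from funext hf]

theorem exists_abs_le_of_periodic {f : ℝ → ℝ} (hf : Continuous f)
    (hper : Function.Periodic f (2 * π)) : ∃ M, ∀ t, |f t| ≤ M := by
  obtain ⟨M, hM⟩ := (hper.isBounded_of_continuous two_pi_pos.ne' hf).exists_norm_le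
  exact ⟨M, fun t => hM _ ⟨t, rfl⟩⟩

/-- The perturbed parameter `u (t + h)` for `u = id + ε u₁`. -/
def perturbedParam (u₁ : ℝ → ℝ) (h : ℝ) (z : ℝ × ℝ) : ℝ := z.2 + h + z.1 * u₁ (z.2 + h)

theorem hasJet_fst_mul_comp {f u₁ : ℝ → ℝ} (hf : ContDiff ℝ 1 f)
    (hper : Function.Periodic f (2 * π)) (hu : Continuous u₁)
    (huper : Function.Periodic u₁ (2 * π)) (h : ℝ) :
    HasJet (fun z => z.1 * f (perturbedParam u₁ h z)) 0 (fun t => f (t + h)) := by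
  obtain ⟨A, hA⟩ := exists_abs_le_of_periodic hf.continuous hper
  obtain ⟨K, hK⟩ := exists_abs_le_of_periodic (hf.continuous_deriv le_rfl) (periodic_deriv hper)
  obtain ⟨M, hM⟩ := exists_abs_le_of_periodic hu huper
  have hK0 : 0 ≤ K := (abs_nonneg _).trans (hK 0)
  refine ⟨isBigO_snd_one (b := fun t => f (t + h)) fun t => hA _,
    .of_bound (K * M) (.of_forall fun z => ?_)⟩
  have hlip : ‖f (perturbedParam u₁ h z) - f (z.2 + h)‖ ≤
      K * ‖perturbedParam u₁ h z - (z.2 + h)‖ :=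
    convex_univ.norm_image_sub_le_of_norm_deriv_le
      (fun x _ => hf.differentiable one_ne_zero x) (fun x _ => hK x) trivial trivial
  have hsub : perturbedParam u₁ h z - (z.2 + h) = z.1 * u₁ (z.2 + h) := by
    simp [perturbedParam]
  rw [zero_add, ← mul_sub, norm_mul, norm_pow]
  rw [hsub, norm_mul] at hlip
  calc ‖z.1‖ * ‖f (perturbedParam u₁ h z) - f (z.2 + h)‖
      ≤ ‖z.1‖ * (K * (‖z.1‖ * M)) := by
        gcongr
        exact hlip.trans (by gcongr; exact hM _)
    _ = K * M * ‖z.1‖ ^ 2 := by ring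

theorem hasJet_perturbedParam_sub {u₁ : ℝ → ℝ} (hu : Continuous u₁)
    (huper : Function.Periodic u₁ (2 * π)) (h : ℝ) :
    HasJet (fun z => perturbedParam u₁ 0 z - perturbedParam u₁ h z) (-h)
      (fun t => u₁ t - u₁ (t + h)) := by
  obtain ⟨M, hM⟩ := exists_abs_le_of_periodic hu huper
  refine ⟨isBigO_snd_one (b := fun t => u₁ t - u₁ (t + h)) fun t =>
     (abs_sub _ _).trans (add_le_add (hM _) (hM _)),
    (isBigO_zero _ _).congr_left fun z => ?_⟩
  simp only [perturbedParam, add_zero]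
  ring

theorem deriv_one_add_mul {p₁ : ℝ → ℝ} (ε : ℝ) :
    deriv (fun s => 1 + ε * p₁ s) = fun s => ε * deriv p₁ s := by
  funext s
  rw [deriv_const_add, deriv_const_mul_field]

theorem hasJet_support {p₁ u₁ : ℝ → ℝ} (hp : ContDiff ℝ 2 p₁)
    (hpper : Function.Periodic p₁ (2 * π)) (hu : Continuous u₁)
    (huper : Function.Periodic u₁ (2 * π)) (h : ℝ) :
    HasJet (fun z => 1 + z.1 * p₁ (perturbedParam u₁ h z)) 1 (fun t => p₁ (t + h)) :=
  ((HasJet.const 1).add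
    (hasJet_fst_mul_comp (hp.of_le one_le_two) hpper hu huper h)).congr_coeff (by simp) (by simp)

theorem hasJet_deriv_support {p₁ u₁ : ℝ → ℝ} (hp : ContDiff ℝ 2 p₁)
    (hpper : Function.Periodic p₁ (2 * π)) (hu : Continuous u₁)
    (huper : Function.Periodic u₁ (2 * π)) (h : ℝ) :
    HasJet (fun z => z.1 * deriv p₁ (perturbedParam u₁ h z)) 0 (fun t => deriv p₁ (t + h)) :=
  hasJet_fst_mul_comp hp.deriv' (periodic_deriv hpper) hu huper h

theorem hasJet_tangentialComp {p₁ u₁ : ℝ → ℝ} (hp : ContDiff ℝ 2 p₁)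
    (hpper : Function.Periodic p₁ (2 * π)) (hu : Continuous u₁)
    (huper : Function.Periodic u₁ (2 * π)) (h : ℝ) :
    HasJet (fun z => tangentialComp (fun s => 1 + z.1 * p₁ s)
        (perturbedParam u₁ 0 z) (perturbedParam u₁ h z)) (-sin h)
      (fun t => deriv p₁ t - p₁ (t + h) * sin h + cos h * (u₁ t - u₁ (t + h))
        - deriv p₁ (t + h) * cos h) := by
  have hx := hasJet_perturbedParam_sub hu huper h
  have hsin := hx.comp analyticAt_sin (hasDerivAt_sin _)
  have hcos := hx.comp analyticAt_cos (hasDerivAt_cos _)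
  have := ((hasJet_deriv_support hp hpper hu huper 0).add
    ((hasJet_support hp hpper hu huper h).mul hsin)).sub
    ((hasJet_deriv_support hp hpper hu huper h).mul hcos)
  simp only [tangentialComp, deriv_one_add_mul]
  refine this.congr_coeff ?_ fun t => ?_
  · rw [sin_neg]; ring
  · rw [sin_neg, cos_neg, add_zero]; ring

theorem hasJet_sqDist {p₁ u₁ : ℝ → ℝ} (hp : ContDiff ℝ 2 p₁)
    (hpper : Function.Periodic p₁ (2 * π)) (hu : Continuous u₁)
    (huper : Function.Periodic u₁ (2 * π)) (h : ℝ) :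
    HasJet (fun z => sqDist (fun s => 1 + z.1 * p₁ s)
        (perturbedParam u₁ 0 z) (perturbedParam u₁ h z)) (2 - 2 * cos h)
      (fun t => 2 * (1 - cos h) * (p₁ t + p₁ (t + h))
        + 2 * sin h * (u₁ (t + h) - u₁ t + deriv p₁ (t + h) - deriv p₁ t)) := by
  have hx := hasJet_perturbedParam_sub hu huper h
  have hsin := hx.comp analyticAt_sin (hasDerivAt_sin _)
  have hcos := hx.comp analyticAt_cos (hasDerivAt_cos _)
  have hP := hasJet_support hp hpper hu huper 0
  have hQ := hasJet_support hp hpper hu huper h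
  have hP' := hasJet_deriv_support hp hpper hu huper 0
  have hQ' := hasJet_deriv_support hp hpper hu huper h
  have h2 := HasJet.const 2
  have := (((((((hP.mul hP).add (hP'.mul hP')).add (hQ.mul hQ)).add (hQ'.mul hQ')).sub
    (((h2.mul hP).mul hQ).mul hcos)).sub (((h2.mul hP).mul hQ').mul hsin)).add
    (((h2.mul hP').mul hQ).mul hsin)).sub (((h2.mul hP').mul hQ').mul hcos)
  simp only [sqDist, deriv_one_add_mul, sq]
  refine this.congr_coeff ?_ fun t => ?_
  · rw [sin_neg, cos_neg]; ring
  · rw [sin_neg, cos_neg, add_zero]; ring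

theorem hasJet_unitTangentialComp {p₁ u₁ : ℝ → ℝ} (hp : ContDiff ℝ 2 p₁)
    (hpper : Function.Periodic p₁ (2 * π)) (hu : Continuous u₁)
    (huper : Function.Periodic u₁ (2 * π))
    {h s c σ : ℝ} (hs : 0 < s) (hcos : cos h = 1 - 2 * s ^ 2)
    (hsin : sin h = 2 * (σ * s) * c) (hσ : σ ^ 2 = 1) (hsc : s ^ 2 + c ^ 2 = 1) :
    HasJet (fun z => tangentialComp (fun s => 1 + z.1 * p₁ s)
        (perturbedParam u₁ 0 z) (perturbedParam u₁ h z) *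
        (√(sqDist (fun s => 1 + z.1 * p₁ s)
          (perturbedParam u₁ 0 z) (perturbedParam u₁ h z)))⁻¹) (-σ * c)
      (fun t => s / 2 * (u₁ (t + h) - u₁ t + deriv p₁ (t + h) + deriv p₁ t)
        - σ * c / 2 * (p₁ (t + h) - p₁ t)) := by
  have ha : 2 - 2 * cos h = (2 * s) ^ 2 := by rw [hcos]; ring
  have ha0 : 2 - 2 * cos h ≠ 0 := by rw [ha]; positivity
  have hsqrt : √(2 - 2 * cos h) = 2 * s := by rw [ha, Real.sqrt_sq (by positivity)]
  have hinv := (hasJet_sqDist hp hpper hu huper h).comp (φ := fun y => (√y)⁻¹)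
    ((Real.contDiffAt_sqrt ha0).inv (by rw [hsqrt]; positivity)).analyticAt
    ((Real.hasDerivAt_sqrt ha0).inv (by rw [hsqrt]; positivity))
  refine ((hasJet_tangentialComp hp hpper hu huper h).mul hinv).congr_coeff ?_ fun t => ?_
  · rw [hsqrt, hsin]
    field_simp
  · rw [hsqrt, hsin, hcos]
    have hc : c ^ 2 = 1 - s ^ 2 := by linarith
    field_simp
    linear_combination
      2 * s * (u₁ (t + h) - u₁ t + deriv p₁ (t + h) - deriv p₁ t) * (c ^ 2 * hσ + hc)

/-- The derivative at `ε = 0` of `E^m(1 + ε p₁, id + ε u₁)`. -/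
noncomputable def firstVariation (m : ℕ) (p₁ u₁ : ℝ → ℝ) (t : ℝ) : ℝ :=
  sin (π / m) / 2 * (u₁ (t + 2 * π / m) + u₁ (t + -(2 * π / m)) - 2 * u₁ t
    + deriv p₁ (t + 2 * π / m) + deriv p₁ (t + -(2 * π / m)) + 2 * deriv p₁ t)
  - cos (π / m) / 2 * (p₁ (t + 2 * π / m) - p₁ (t + -(2 * π / m)))

theorem errfun_sub_firstVariation_isBigO {p₁ u₁ : ℝ → ℝ} (hp : ContDiff ℝ 2 p₁)
    (hpper : Function.Periodic p₁ (2 * π)) (hu : Continuous u₁)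
    (huper : Function.Periodic u₁ (2 * π)) {m : ℕ} (hm : 2 < m) :
    (fun z : ℝ × ℝ => errfun m (fun s => 1 + z.1 * p₁ s) (fun s => s + z.1 * u₁ s) z.2
      - z.1 * firstVariation m p₁ u₁ z.2) =O[uniformZero] fun z => z.1 ^ 2 := by
  have hs : 0 < sin (π / m) := by
    have hm' : (1 : ℝ) < m := by exact_mod_cast hm.trans' one_lt_two
    exact sin_pos_of_pos_of_lt_pi (by positivity) (div_lt_self pi_pos hm')
  have hδ : 2 * π / m = 2 * (π / m) := by ring
  have hsc := sin_sq_add_cos_sq (π / m)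
  have hcos : cos (2 * π / m) = 1 - 2 * sin (π / m) ^ 2 := by
    rw [hδ, cos_two_mul]; linarith
  have hsin : sin (2 * π / m) = 2 * (1 * sin (π / m)) * cos (π / m) := by
    rw [hδ, sin_two_mul]; ring
  have hG := (hasJet_unitTangentialComp hp hpper hu huper hs hcos hsin (by norm_num) hsc).add
    (hasJet_unitTangentialComp hp hpper hu huper hs (h := -(2 * π / m)) (σ := -1)
      (by rw [cos_neg, hcos]) (by rw [sin_neg, hsin]; ring) (by norm_num) hsc)
  replace hG := hG.congr_coeff (c := 0) (d := firstVariation m p₁ u₁) (by ring)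
    fun t => by simp only [firstVariation]; ring
  obtain ⟨A, hA⟩ := exists_abs_le_of_periodic hp.continuous hpper
  obtain ⟨B, hB⟩ := exists_abs_le_of_periodic ((hp.deriv' (n := 1)).continuous_deriv le_rfl)
    (periodic_deriv (periodic_deriv hpper))
  have hρ : (fun z => p₁ (perturbedParam u₁ 0 z) + deriv (deriv p₁) (perturbedParam u₁ 0 z))
      =O[uniformZero] fun _ => (1 : ℝ) :=
    .of_bound (A + B) (.of_forall fun z => by
      simpa using (abs_add_le _ _).trans (add_le_add (hA _) (hB _)))
  have hmain := hG.remainder.add ((isBigO_refl Prod.fst uniformZero).mul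
    (hρ.mul hG.sub_const_isBigO) |>.congr_right (g₂ := fun z => z.1 ^ 2) fun z => by ring)
  refine hmain.congr' ?_ .rfl
  have hpos {h : ℝ} (hh : cos h = 1 - 2 * sin (π / m) ^ 2) :
      ∀ᶠ z in uniformZero, 0 < sqDist (fun s => 1 + z.1 * p₁ s)
        (perturbedParam u₁ 0 z) (perturbedParam u₁ h z) :=
    (hasJet_sqDist hp hpper hu huper h).tendsto.eventually_const_lt (by rw [hh]; nlinarith)
  filter_upwards [hpos hcos, hpos ((cos_neg _).trans hcos)] with z h1 h2
  have hx : perturbedParam u₁ 0 z = z.2 + z.1 * u₁ z.2 := by simp [perturbedParam]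
  have hpz : ContDiff ℝ 2 (fun s => 1 + z.1 * p₁ s) :=
    contDiff_const.add (contDiff_const.mul hp)
  rw [hx] at h1 h2
  rw [errfun_eq (u := fun s => s + z.1 * u₁ s) hpz h1 h2]
  simp only [hx, deriv_one_add_mul, deriv_const_mul_field]
  simp only [perturbedParam]
  ring

theorem isBigO_errfun_iff {p₁ u₁ : ℝ → ℝ} (hp : ContDiff ℝ 2 p₁)
    (hpper : Function.Periodic p₁ (2 * π)) (hu : Continuous u₁)
    (huper : Function.Periodic u₁ (2 * π)) {m : ℕ} (hm : 2 < m) :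
    ((fun z : ℝ × ℝ => errfun m (fun s => 1 + z.1 * p₁ s) (fun s => s + z.1 * u₁ s) z.2)
      =O[uniformZero] fun z => z.1 ^ 2) ↔ ∀ t, firstVariation m p₁ u₁ t = 0 := by
  have hE := errfun_sub_firstVariation_isBigO hp hpper hu huper hm
  refine ⟨fun h t => ?_, fun h => by simpa [h] using hE⟩
  obtain ⟨C, -, ε₁, hε₁, hC⟩ :=
    isBigO_uniformZero_iff.1 ((h.sub hE).congr_left fun z => sub_sub_cancel _ _)
  have hlim : Tendsto (fun ε : ℝ => C * ε) (𝓝[>] 0) (𝓝 0) := by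
    simpa using ((continuous_const_mul C).tendsto 0).mono_left nhdsWithin_le_nhds
  refine abs_nonpos_iff.1 (ge_of_tendsto hlim ?_)
  filter_upwards [Ioc_mem_nhdsGT hε₁] with ε hε
  have hle := hC ε hε.1 hε.2 t
  rw [abs_mul, abs_of_pos hε.1] at hle
  exact le_of_mul_le_mul_left (hle.trans_eq (by ring)) hε.1

theorem continuous_firstVariation {p₁ u₁ : ℝ → ℝ} (hp : ContDiff ℝ 2 p₁)
    (hu : Continuous u₁) (m : ℕ) : Continuous (firstVariation m p₁ u₁) := by
  have h0 := hp.continuous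
  have h1 := (hp.deriv' (n := 1)).continuous
  unfold firstVariation
  fun_prop

theorem periodic_firstVariation {p₁ u₁ : ℝ → ℝ}
    (hpper : Function.Periodic p₁ (2 * π)) (huper : Function.Periodic u₁ (2 * π)) (m : ℕ) :
    Function.Periodic (firstVariation m p₁ u₁) (2 * π) := fun t => by
  simp only [firstVariation, add_right_comm t (2 * π), hpper _, huper _,
    periodic_deriv hpper _]

section Fourier

theorem fourierCoef_eq_fourierCoeff {f : ℝ → ℝ} [Fact (0 < 2 * π)]
    (F : AddCircle (2 * π) → ℂ) (hF : ∀ t : ℝ, F t = f t) (k : ℤ) :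
    fourierCoef f k = fourierCoeff F k := by
  rw [fourierCoeff_eq_intervalIntegral F k 0, fourierCoef, zero_add, Complex.real_smul]
  push_cast
  congr 1
  refine intervalIntegral.integral_congr fun t _ => ?_
  simp only [hF, fourier_coe_apply, smul_eq_mul]
  rw [mul_comm]
  congr 2
  have : (π : ℂ) ≠ 0 := by exact_mod_cast pi_ne_zero
  push_cast
  field_simp

theorem forall_fourierCoef_eq_zero_iff {f : ℝ → ℝ} (hf : Continuous f)
    (hper : Function.Periodic f (2 * π)) :
    (∀ k, fourierCoef f k = 0) ↔ ∀ t, f t = 0 := by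
  refine ⟨fun h t => ?_, fun h k => by simp [fourierCoef, h]⟩
  have : Fact (0 < 2 * π) := ⟨two_pi_pos⟩
  have hper' : Function.Periodic (fun t => (f t : ℂ)) (2 * π) := fun t => by simp [hper t]
  let F : C(AddCircle (2 * π), ℂ) :=
    ⟨hper'.lift, continuous_coinduced_dom.2 (Complex.continuous_ofReal.comp hf)⟩
  have hF : ∀ t : ℝ, F t = f t := fun t => hper'.lift_coe t
  have hcoeff : fourierCoeff F = 0 := funext fun k => by
    rw [← fourierCoef_eq_fourierCoeff F hF, h, Pi.zero_apply]
  have hsum := has_pointwise_sum_fourier_series_of_summable (f := F)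
    (by rw [hcoeff]; exact summable_zero) t
  rw [hcoeff, hF] at hsum
  simp only [Pi.zero_apply, zero_smul] at hsum
  exact_mod_cast hsum.unique hasSum_zero

variable {f g : ℝ → ℝ}

theorem intervalIntegrable_mul_exp (hf : Continuous f) (k : ℤ) (a b : ℝ) :
    IntervalIntegrable (fun t => (f t : ℂ) * Complex.exp (-Complex.I * k * t))
      MeasureTheory.volume a b :=
  Continuous.intervalIntegrable (by fun_prop) _ _

theorem fourierCoef_add (hf : Continuous f) (hg : Continuous g) (k : ℤ) :
    fourierCoef (fun t => f t + g t) k = fourierCoef f k + fourierCoef g k := by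
  rw [fourierCoef, fourierCoef, fourierCoef, ← mul_add, ← intervalIntegral.integral_add
    (intervalIntegrable_mul_exp hf k _ _) (intervalIntegrable_mul_exp hg k _ _)]
  simp only [Complex.ofReal_add, add_mul]

theorem fourierCoef_const_mul (c : ℝ) (f : ℝ → ℝ) (k : ℤ) :
    fourierCoef (fun t => c * f t) k = c * fourierCoef f k := by
  rw [fourierCoef, fourierCoef, mul_left_comm, ← intervalIntegral.integral_const_mul (c : ℂ)]
  simp only [Complex.ofReal_mul, mul_assoc]

theorem fourierCoef_sub (hf : Continuous f) (hg : Continuous g) (k : ℤ) :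
    fourierCoef (fun t => f t - g t) k = fourierCoef f k - fourierCoef g k := by
  have := fourierCoef_add hf (g := fun t => -1 * g t) (by fun_prop) k
  rw [fourierCoef_const_mul] at this
  simpa [sub_eq_add_neg] using this

theorem periodic_exp_neg_I_mul (k : ℤ) :
    Function.Periodic (fun t : ℝ => Complex.exp (-Complex.I * k * t)) (2 * π) := fun t => by
  rw [Complex.exp_eq_exp_iff_exists_int]
  exact ⟨-k, by push_cast; ring⟩

theorem fourierCoef_comp_add (hper : Function.Periodic f (2 * π)) (h : ℝ) (k : ℤ) :
    fourierCoef (fun t => f (t + h)) k = Complex.exp (Complex.I * k * h) * fourierCoef f k := by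
  have hexp (t : ℝ) : (f (t + h) : ℂ) * Complex.exp (-Complex.I * k * t) =
      Complex.exp (Complex.I * k * h) *
        ((f (t + h) : ℂ) * Complex.exp (-Complex.I * k * (t + h : ℝ))) := by
    rw [mul_left_comm, ← Complex.exp_add]
    congr 2
    push_cast
    ring
  have hper' : Function.Periodic
      (fun t : ℝ => (f t : ℂ) * Complex.exp (-Complex.I * k * t)) (2 * π) := fun t => by
    simp only [hper t, periodic_exp_neg_I_mul k t]
  simp only [fourierCoef, hexp]
  rw [intervalIntegral.integral_const_mul, mul_left_comm, intervalIntegral.integral_comp_add_right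
    (fun t : ℝ => (f t : ℂ) * Complex.exp (-Complex.I * k * t)), zero_add, add_comm (2 * π) h,
    hper'.intervalIntegral_add_eq h 0, zero_add]

theorem fourierCoef_deriv (hf : ContDiff ℝ 1 f) (hper : Function.Periodic f (2 * π)) (k : ℤ) :
    fourierCoef (deriv f) k = Complex.I * k * fourierCoef f k := by
  have hu (t : ℝ) : HasDerivAt (fun t : ℝ => (f t : ℂ)) ((deriv f t : ℝ) : ℂ) t :=
    (hf.differentiable one_ne_zero t).hasDerivAt.ofReal_comp
  have hv (t : ℝ) : HasDerivAt (fun t : ℝ => Complex.exp (-Complex.I * k * t))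
      (Complex.exp (-Complex.I * k * t) * (-Complex.I * k)) t := by
    simpa using ((Complex.ofRealCLM.hasDerivAt (x := t)).const_mul (-Complex.I * (k : ℂ))).cexp
  have hd := hf.continuous_deriv le_rfl
  have hparts := intervalIntegral.integral_mul_deriv_eq_deriv_mul (a := 0) (b := 2 * π)
    (fun t _ => hu t) (fun t _ => hv t)
    (Continuous.intervalIntegrable (by fun_prop) _ _)
    (Continuous.intervalIntegrable (by fun_prop) _ _)
  have h0 : f (2 * π) = f 0 := by simpa using hper 0
  have h1 : Complex.exp (-Complex.I * k * (2 * π : ℝ)) = Complex.exp (-Complex.I * k * (0 : ℝ)) := by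
    simpa using periodic_exp_neg_I_mul k 0
  simp only [← mul_assoc _ (Complex.exp _)] at hparts
  rw [h0, h1, sub_self, zero_sub, intervalIntegral.integral_mul_const] at hparts
  simp only [fourierCoef]
  linear_combination (1 / (2 * π) : ℂ) * hparts

end Fourier

theorem fourierCoef_firstVariation {p₁ u₁ : ℝ → ℝ} (hp : ContDiff ℝ 2 p₁)
    (hpper : Function.Periodic p₁ (2 * π)) (hu : Continuous u₁)
    (huper : Function.Periodic u₁ (2 * π)) (m : ℕ) (k : ℤ) :
    fourierCoef (firstVariation m p₁ u₁) k =
      2 * (sin (π / m) * (Complex.I * k * (cos (π * k / m) : ℂ) ^ 2 * fourierCoef p₁ k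
          - (sin (π * k / m) : ℂ) ^ 2 * fourierCoef u₁ k)
        - cos (π / m) * (Complex.I * sin (π * k / m) * cos (π * k / m) * fourierCoef p₁ k)) := by
  have h0 := hp.continuous
  have h1 := (hp.deriv' (n := 1)).continuous
  have hdper := periodic_deriv hpper
  have he (σ : ℝ) (hσ : σ ^ 2 = 1) : Complex.exp (Complex.I * k * ((σ * (2 * π / m) : ℝ) : ℂ)) =
      (cos (π * k / m) + Complex.I * σ * sin (π * k / m)) ^ 2 := by
    have harg : Complex.I * k * ((σ * (2 * π / m) : ℝ) : ℂ) =
        ((2 : ℕ) : ℂ) * (((σ * (π * k / m) : ℝ) : ℂ) * Complex.I) := by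
      push_cast; ring
    rw [harg, Complex.exp_nat_mul, Complex.exp_mul_I, ← Complex.ofReal_cos, ← Complex.ofReal_sin]
    rcases eq_or_eq_neg_of_sq_eq_sq σ 1 (by rw [hσ, one_pow]) with rfl | rfl
    · simp [mul_comm]
    · simp [mul_comm]
  have hpos := he 1 (by norm_num)
  have hneg := he (-1) (by norm_num)
  rw [one_mul] at hpos
  rw [neg_one_mul] at hneg
  unfold firstVariation
  rw [fourierCoef_sub (by fun_prop) (by fun_prop), fourierCoef_const_mul, fourierCoef_const_mul,
    fourierCoef_add (by fun_prop) (by fun_prop), fourierCoef_add (by fun_prop) (by fun_prop),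
    fourierCoef_add (by fun_prop) (by fun_prop), fourierCoef_sub (by fun_prop) (by fun_prop),
    fourierCoef_sub (by fun_prop) (by fun_prop), fourierCoef_add (by fun_prop) (by fun_prop),
    fourierCoef_const_mul, fourierCoef_const_mul]
  simp only [fourierCoef_comp_add huper, fourierCoef_comp_add hpper, fourierCoef_comp_add hdper,
    fourierCoef_deriv (hp.of_le one_le_two) hpper, hpos, hneg]
  have hsc : (sin (π * k / m) : ℂ) ^ 2 + (cos (π * k / m) : ℂ) ^ 2 = 1 := by
    exact_mod_cast sin_sq_add_cos_sq (π * k / m)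
  generalize (sin (π * k / m) : ℂ) = S at *
  generalize (cos (π * k / m) : ℂ) = C at *
  push_cast
  linear_combination Complex.sin (π / m) * (
    (fourierCoef u₁ k - Complex.I * k * fourierCoef p₁ k) * hsc
    + S ^ 2 * (fourierCoef u₁ k + Complex.I * k * fourierCoef p₁ k) * Complex.I_sq)

theorem sin_pi_mul_div_eq_zero_iff {m : ℕ} (hm : m ≠ 0) (k : ℤ) :
    sin (π * k / m) = 0 ↔ (m : ℤ) ∣ k := by
  have hm' : (m : ℝ) ≠ 0 := by exact_mod_cast hm
  rw [sin_eq_zero_iff, dvd_iff_exists_eq_mul_right]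
  refine exists_congr fun n => ?_
  rw [eq_div_iff hm', ← Int.cast_inj (α := ℝ)]
  push_cast
  constructor <;> intro h
  · exact mul_left_cancel₀ pi_ne_zero (by linear_combination -h)
  · rw [h]; ring

/-- For `m > 2`: `sup_t |E^m(1 + εp₁, id + εu₁)(t)| = O(ε²)` as `ε → 0⁺`
if and only if `û₁(k) = a_{m,k} p̂₁(k)` for all `k` not divisible by `m`, and
`p̂₁(k) = 0` for all nonzero `k` divisible by `m`, where
`a_{m,k} = i(k cot²(πk/m) − cot(π/m) cot(πk/m))`. -/
theorem stmt_6 (m : ℕ) (hm : 2 < m) (p₁ u₁ : ℝ → ℝ)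
    (hp : ContDiff ℝ 2 p₁) (hpper : ∀ t, p₁ (t + 2 * π) = p₁ t)
    (hu : Continuous u₁) (huper : ∀ t, u₁ (t + 2 * π) = u₁ t) :
    (∃ C > 0, ∃ ε₁ > 0, ∀ ε : ℝ, 0 < ε → ε ≤ ε₁ → ∀ t : ℝ,
        |errfun m (fun s => 1 + ε * p₁ s) (fun s => s + ε * u₁ s) t| ≤ C * ε ^ 2)
    ↔ ((∀ k : ℤ, ¬ (m : ℤ) ∣ k →
          fourierCoef u₁ k
            = Complex.I * ((k : ℂ) * (Real.cot (π * k / m) : ℂ) ^ 2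
                - (Real.cot (π / m) : ℂ) * (Real.cot (π * k / m) : ℂ))
              * fourierCoef p₁ k)
        ∧ (∀ k : ℤ, k ≠ 0 → (m : ℤ) ∣ k → fourierCoef p₁ k = 0)) := by
  have hE := isBigO_errfun_iff hp hpper hu huper hm
  rw [isBigO_uniformZero_iff] at hE
  rw [hE, ← forall_fourierCoef_eq_zero_iff (continuous_firstVariation hp hu m)
    (periodic_firstVariation hpper huper m), ← forall_and]
  refine forall_congr' fun k => ?_
  have hm1 : (1 : ℝ) < m := by exact_mod_cast hm.trans' one_lt_two
  have hs : (sin (π / m) : ℂ) ≠ 0 := by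
    exact_mod_cast (sin_pos_of_pos_of_lt_pi (by positivity) (div_lt_self pi_pos hm1)).ne'
  have hsc : (sin (π * k / m) : ℂ) ^ 2 + (cos (π * k / m) : ℂ) ^ 2 = 1 := by
    exact_mod_cast sin_sq_add_cos_sq (π * k / m)
  rw [fourierCoef_firstVariation hp hpper hu huper, mul_eq_zero_iff_left two_ne_zero]
  have hS := sin_pi_mul_div_eq_zero_iff (by omega : m ≠ 0) k
  simp only [cot_eq_cos_div_sin, Complex.ofReal_div]
  rw [← Complex.ofReal_eq_zero] at hS
  generalize (sin (π * k / m) : ℂ) = S at *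
  generalize (cos (π * k / m) : ℂ) = C at *
  generalize (sin (π / m) : ℂ) = s at *
  by_cases hk : (m : ℤ) ∣ k
  · have hS0 := hS.2 hk
    have hC : C ≠ 0 := fun h => by simp [hS0, h] at hsc
    simp [hk, hS0, hs, hC, or_iff_not_imp_left]
  · have hS0 := hS.not.2 hk
    simp only [hk, not_false_eq_true, forall_true_left, IsEmpty.forall_iff, implies_true, and_true]
    constructor <;> intro h
    · field_simp
      linear_combination -h
    · rw [h]
      field_simp
      ring
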